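/- arXiv:2311.16382 — 2 statements merged into one kernel-verified Lean document; each statement's English description precedes it below -/
import Mathlib

section
/- Let T be an ideal technology set with (x^min, y^max) ∉ T, and let a GS path-based model on T use, for some θ_min ∈ [0,1) ∩ D, the GS range directions. Then the model satisfies strict monotonicity: whenever (x_o,y_o) ∈ T dominates (x_p,y_p) ∈ T, the efficiency scores satisfy θ*_o > θ*_p. -/
open Finset

noncomputable section

variable {m s n : ℕ}

/-- The VRS technology set generated by data matrices `X`, `Y`. -/
def Tset (X : Matrix (Fin m) (Fin n) ℝ) (Y : Matrix (Fin s) (Fin n) ℝ) :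
    Set ((Fin m → ℝ) × (Fin s → ℝ)) :=
  {p | ∃ lam : Fin n → ℝ, (∀ j, 0 ≤ lam j) ∧ (∑ j, lam j) = 1 ∧
    Matrix.mulVec X lam ≤ p.1 ∧ p.2 ≤ Matrix.mulVec Y lam}

/-- `p` weakly dominates `q`. -/
def WeakDom (p q : (Fin m → ℝ) × (Fin s → ℝ)) : Prop :=
  p.1 ≤ q.1 ∧ q.2 ≤ p.2

/-- `p` dominates `q`. -/
def Dom (p q : (Fin m → ℝ) × (Fin s → ℝ)) : Prop :=
  WeakDom p q ∧ p ≠ q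

/-- A unit is strongly efficient if it lies in `T` and no point of `T` dominates it. -/
def StrongEff (X : Matrix (Fin m) (Fin n) ℝ) (Y : Matrix (Fin s) (Fin n) ℝ)
    (p : (Fin m → ℝ) × (Fin s → ℝ)) : Prop :=
  p ∈ Tset X Y ∧ ∀ q ∈ Tset X Y, ¬ Dom q p

/-- The strongly efficient frontier `∂^S T`. -/
def strongFrontier (X : Matrix (Fin m) (Fin n) ℝ) (Y : Matrix (Fin s) (Fin n) ℝ) :
    Set ((Fin m → ℝ) × (Fin s → ℝ)) :=
  {p | StrongEff X Y p}

/-- The weakly (but not strongly) efficient frontier `∂^W T = ∂T \ ∂^S T`. -/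
def weakFrontier (X : Matrix (Fin m) (Fin n) ℝ) (Y : Matrix (Fin s) (Fin n) ℝ) :
    Set ((Fin m → ℝ) × (Fin s → ℝ)) :=
  frontier (Tset X Y) \ strongFrontier X Y

/-- Componentwise minimum of the input data. -/
def xmin (X : Matrix (Fin m) (Fin n) ℝ) : Fin m → ℝ := fun i => ⨅ j, X i j

/-- Componentwise maximum of the output data. -/
def ymax (Y : Matrix (Fin s) (Fin n) ℝ) : Fin s → ℝ := fun r => ⨆ j, Y r j

/-- The ideal point `(x^min, y^max)`. -/
def idealPoint (X : Matrix (Fin m) (Fin n) ℝ) (Y : Matrix (Fin s) (Fin n) ℝ) :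
    (Fin m → ℝ) × (Fin s → ℝ) :=
  (xmin X, ymax Y)

/-- `T` is an ideal technology: every weakly-but-not-strongly efficient point shares at
least one coordinate with the ideal point. -/
def IdealTech (X : Matrix (Fin m) (Fin n) ℝ) (Y : Matrix (Fin s) (Fin n) ℝ) : Prop :=
  ∀ p ∈ weakFrontier X Y, (∃ i, p.1 i = xmin X i) ∨ (∃ r, p.2 r = ymax Y r)

/-- The pair of path-generating functions `ψ^x, ψ^y` of a GS path-based model, together
with their domains and the standing assumptions (A1)–(A4). -/
structure GSPsi where
  ψx : ℝ → ℝ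
  ψy : ℝ → ℝ
  Dx : Set ℝ
  Dy : Set ℝ
  hDx : Dx = Set.univ ∨ Dx = Set.Ioi (0 : ℝ)
  hDy : Dy = Set.univ ∨ Dy = Set.Ioi (0 : ℝ)
  hψx_diff : DifferentiableOn ℝ ψx Dx
  hψy_diff : DifferentiableOn ℝ ψy Dy
  hψx_conc : ConcaveOn ℝ Dx ψx
  hψy_conv : ConvexOn ℝ Dy ψy
  hψx_mono : StrictMonoOn ψx Dx
  hψy_anti : StrictAntiOn ψy Dy
  hone_x : (1 : ℝ) ∈ Dx
  hone_y : (1 : ℝ) ∈ Dy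
  hψx_one : ψx 1 = 1
  hψy_one : ψy 1 = 1
  himx : ψx '' Dx = Set.univ ∨ ψx '' Dx = Set.Ioi (0 : ℝ)
  himy : ψy '' Dy = Set.univ ∨ ψy '' Dy = Set.Ioi (0 : ℝ)

/-- The common domain `D = dom ψ^x ∩ dom ψ^y`. -/
def GSPsi.D (P : GSPsi) : Set ℝ := P.Dx ∩ P.Dy

/-- The GS range direction with parameter `θ_min` for the unit `p`. -/
def rangeDir (P : GSPsi) (X : Matrix (Fin m) (Fin n) ℝ) (Y : Matrix (Fin s) (Fin n) ℝ)
    (θmin : ℝ) (p : (Fin m → ℝ) × (Fin s → ℝ)) : (Fin m → ℝ) × (Fin s → ℝ) :=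
  ((1 - P.ψx θmin)⁻¹ • (p.1 - xmin X), (P.ψy θmin - 1)⁻¹ • (ymax Y - p.2))

/-- Input component of the path with GS range directions. -/
def pathRx (P : GSPsi) (X : Matrix (Fin m) (Fin n) ℝ) (Y : Matrix (Fin s) (Fin n) ℝ)
    (θmin : ℝ) (p : (Fin m → ℝ) × (Fin s → ℝ)) (θ : ℝ) : Fin m → ℝ :=
  p.1 + (P.ψx θ - 1) • (rangeDir P X Y θmin p).1

/-- Output component of the path with GS range directions. -/
def pathRy (P : GSPsi) (X : Matrix (Fin m) (Fin n) ℝ) (Y : Matrix (Fin s) (Fin n) ℝ)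
    (θmin : ℝ) (p : (Fin m → ℝ) × (Fin s → ℝ)) (θ : ℝ) : Fin s → ℝ :=
  p.2 + (P.ψy θ - 1) • (rangeDir P X Y θmin p).2

/-- The path with GS range directions. -/
def pathR (P : GSPsi) (X : Matrix (Fin m) (Fin n) ℝ) (Y : Matrix (Fin s) (Fin n) ℝ)
    (θmin : ℝ) (p : (Fin m → ℝ) × (Fin s → ℝ)) (θ : ℝ) :
    (Fin m → ℝ) × (Fin s → ℝ) :=
  (pathRx P X Y θmin p θ, pathRy P X Y θmin p θ)

/-- `θ` is feasible for `p` in the GS programme with GS range directions. -/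
def feasibleR (P : GSPsi) (X : Matrix (Fin m) (Fin n) ℝ) (Y : Matrix (Fin s) (Fin n) ℝ)
    (θmin : ℝ) (p : (Fin m → ℝ) × (Fin s → ℝ)) (θ : ℝ) : Prop :=
  θ ∈ P.D ∧ ∃ lam : Fin n → ℝ, (∀ j, 0 ≤ lam j) ∧ (∑ j, lam j) = 1 ∧
    Matrix.mulVec X lam ≤ pathRx P X Y θmin p θ ∧
    pathRy P X Y θmin p θ ≤ Matrix.mulVec Y lam

/-- The image under a linear map of a face of the nonnegative orthant is closed. -/
theorem isClosed_image_nonneg_face {ι F : Type*} [Fintype ι] [NormedAddCommGroup F]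
    [NormedSpace ℝ F] (L : (ι → ℝ) →ₗ[ℝ] F) (S : Finset ι) :
    IsClosed (L '' {x | 0 ≤ x ∧ ∀ i ∉ S, x i = 0}) := by
  classical
  induction S using Finset.strongInduction with
  | H S ih =>
  by_cases hinj : ∀ v : ι → ℝ, (∀ i ∉ S, v i = 0) → L v = 0 → v = 0
  · let W : Submodule ℝ (ι → ℝ) :=
      { carrier := {x | ∀ i ∉ S, x i = 0}
        add_mem' := fun {a b} ha hb i hi => by simp [ha i hi, hb i hi]
        zero_mem' := fun i _ => rfl
        smul_mem' := fun c x hx i hi => by simp [hx i hi] }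
    have hker : LinearMap.ker (L.domRestrict W) = ⊥ := by
      rw [LinearMap.ker_eq_bot']
      intro w hw
      exact Subtype.ext (hinj w.1 w.2 hw)
    have hemb := LinearMap.isClosedEmbedding_of_injective hker
    have hcl : IsClosed {w : W | (0 : ι → ℝ) ≤ w.1} :=
      isClosed_le continuous_const continuous_subtype_val
    convert hemb.isClosedMap _ hcl using 1
    ext y
    constructor
    · rintro ⟨x, ⟨hx0, hxS⟩, rfl⟩
      exact ⟨⟨x, hxS⟩, hx0, rfl⟩
    · rintro ⟨w, hw, rfl⟩
      exact ⟨w.1, ⟨hw, w.2⟩, rfl⟩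
  · have hv : ∃ v : ι → ℝ, (∀ i ∉ S, v i = 0) ∧ L v = 0 ∧ ∃ i, 0 < v i := by
      push Not at hinj
      obtain ⟨v, hvS, hLv, hv0⟩ := hinj
      obtain ⟨i, hi⟩ := Function.ne_iff.mp hv0
      rcases lt_or_gt_of_ne hi with h | h
      · exact ⟨-v, fun j hj => by simp [hvS j hj], by simp [hLv], i, by simpa using h⟩
      · exact ⟨v, hvS, hLv, i, h⟩
    obtain ⟨v, hvS, hLv, i₀, hi₀⟩ := hv
    have hunion : L '' {x | 0 ≤ x ∧ ∀ i ∉ S, x i = 0} =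
        ⋃ i ∈ S, L '' {x | 0 ≤ x ∧ ∀ j ∉ S.erase i, x j = 0} := by
      ext y
      simp only [Set.mem_iUnion]
      constructor
      · rintro ⟨x, ⟨hx0, hxS⟩, rfl⟩
        obtain ⟨i, hi, hmin⟩ := Finset.exists_min_image (univ.filter fun i => 0 < v i)
          (fun i => x i / v i) ⟨i₀, by simpa using hi₀⟩
        have hvi : 0 < v i := by simpa using hi
        have hiS : i ∈ S := by
          by_contra h
          exact hvi.ne' (hvS i h)
        have ht : 0 ≤ x i / v i := div_nonneg (hx0 i) hvi.le
        refine ⟨i, hiS, x - (x i / v i) • v, ⟨fun j => ?_, fun j hj => ?_⟩, by simp [hLv]⟩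
        · simp only [Pi.zero_apply, Pi.sub_apply, Pi.smul_apply, smul_eq_mul, sub_nonneg]
          rcases lt_or_ge 0 (v j) with h | h
          · exact (le_div_iff₀ h).mp (hmin j (by simpa using h))
          · exact (mul_nonpos_of_nonneg_of_nonpos ht h).trans (hx0 j)
        · by_cases hji : j = i
          · subst hji
            simp [hvi.ne']
          · have hjS : j ∉ S := fun h => hj (Finset.mem_erase.mpr ⟨hji, h⟩)
            simp [hxS j hjS, hvS j hjS]
      · rintro ⟨i, -, x, ⟨hx0, hxS⟩, rfl⟩
        exact ⟨x, ⟨hx0, fun j hj => hxS j fun h => hj (Finset.mem_of_mem_erase h)⟩, rfl⟩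
    rw [hunion]
    exact isClosed_biUnion_finset fun i hi => ih _ (Finset.erase_ssubset hi)

/-- Finitely generated cones are closed. -/
theorem isClosed_image_nonneg {ι F : Type*} [Fintype ι] [NormedAddCommGroup F]
    [NormedSpace ℝ F] (L : (ι → ℝ) →ₗ[ℝ] F) : IsClosed (L '' {x | 0 ≤ x}) := by
  simpa using isClosed_image_nonneg_face L univ

section Technology

variable {X : Matrix (Fin m) (Fin n) ℝ} {Y : Matrix (Fin s) (Fin n) ℝ}

theorem mem_Tset_of_weakDom {p q : (Fin m → ℝ) × (Fin s → ℝ)} (hp : p ∈ Tset X Y)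
    (h : WeakDom p q) : q ∈ Tset X Y := by
  obtain ⟨lam, h0, h1, hx, hy⟩ := hp
  exact ⟨lam, h0, h1, hx.trans h.1, h.2.trans hy⟩

theorem convex_Tset : Convex ℝ (Tset X Y) := by
  rintro p ⟨l, hl0, hl1, hlx, hly⟩ q ⟨k, hk0, hk1, hkx, hky⟩ a b ha hb hab
  refine ⟨a • l + b • k, fun j => ?_, ?_, ?_, ?_⟩
  · exact add_nonneg (mul_nonneg ha (hl0 j)) (mul_nonneg hb (hk0 j))
  · simp [Finset.sum_add_distrib, ← Finset.mul_sum, hl1, hk1, hab]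
  · rw [Matrix.mulVec_add, Matrix.mulVec_smul, Matrix.mulVec_smul]
    exact add_le_add (smul_le_smul_of_nonneg_left hlx ha) (smul_le_smul_of_nonneg_left hkx hb)
  · rw [Matrix.mulVec_add, Matrix.mulVec_smul, Matrix.mulVec_smul]
    exact add_le_add (smul_le_smul_of_nonneg_left hly ha) (smul_le_smul_of_nonneg_left hky hb)

theorem xmin_le_of_mem_Tset {p : (Fin m → ℝ) × (Fin s → ℝ)} (hp : p ∈ Tset X Y) :
    xmin X ≤ p.1 := by
  obtain ⟨l, hl0, hl1, hlx, -⟩ := hp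
  intro i
  calc xmin X i = ∑ j, xmin X i * l j := by rw [← Finset.mul_sum, hl1, mul_one]
    _ ≤ ∑ j, X i j * l j := Finset.sum_le_sum fun j _ =>
        mul_le_mul_of_nonneg_right (ciInf_le (Set.finite_range _).bddBelow j) (hl0 j)
    _ ≤ p.1 i := hlx i

theorem le_ymax_of_mem_Tset {p : (Fin m → ℝ) × (Fin s → ℝ)} (hp : p ∈ Tset X Y) :
    p.2 ≤ ymax Y := by
  obtain ⟨l, hl0, hl1, -, hly⟩ := hp
  intro r
  calc p.2 r ≤ ∑ j, Y r j * l j := hly r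
    _ ≤ ∑ j, ymax Y r * l j := Finset.sum_le_sum fun j _ =>
        mul_le_mul_of_nonneg_right (le_ciSup (Set.finite_range _).bddAbove j) (hl0 j)
    _ = ymax Y r := by rw [← Finset.mul_sum, hl1, mul_one]

/-- The linear map whose image of the nonnegative orthant is the cone of feasible directions
of `Tset X Y` at `z`; the second and third blocks of variables are slacks. -/
def feasDirMap (X : Matrix (Fin m) (Fin n) ℝ) (Y : Matrix (Fin s) (Fin n) ℝ)
    (z : (Fin m → ℝ) × (Fin s → ℝ)) :
    (Fin n ⊕ Fin m ⊕ Fin s → ℝ) →ₗ[ℝ] (Fin m → ℝ) × (Fin s → ℝ) where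
  toFun w :=
    (X.mulVec (fun j => w (.inl j)) - (∑ j, w (.inl j)) • z.1 + fun i => w (.inr (.inl i)),
     Y.mulVec (fun j => w (.inl j)) - (∑ j, w (.inl j)) • z.2 - fun r => w (.inr (.inr r)))
  map_add' v w := by
    ext k <;>
    simp [Matrix.mulVec, dotProduct, mul_add, Finset.sum_add_distrib] <;> ring
  map_smul' c w := by
    ext k <;>
    simp [Matrix.mulVec, dotProduct, mul_left_comm, ← Finset.mul_sum] <;> ring

/-- The cone of feasible directions of the polyhedron `Tset X Y` at one of its points is closed. -/
theorem isClosed_feasDir {z : (Fin m → ℝ) × (Fin s → ℝ)} (hz : z ∈ Tset X Y) :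
    IsClosed {d : (Fin m → ℝ) × (Fin s → ℝ) | ∃ c : ℝ, 0 < c ∧ z + c • d ∈ Tset X Y} := by
  suffices h : {d : (Fin m → ℝ) × (Fin s → ℝ) | ∃ c : ℝ, 0 < c ∧ z + c • d ∈ Tset X Y} =
      feasDirMap X Y z '' {w | 0 ≤ w} from h ▸ isClosed_image_nonneg _
  ext d
  constructor
  · rintro ⟨c, hc, l, hl0, hl1, hlx, hly⟩
    have hcinv : 0 ≤ c⁻¹ := (inv_pos.mpr hc).le
    refine ⟨Sum.elim (c⁻¹ • l) (Sum.elim (d.1 - c⁻¹ • (X.mulVec l - z.1))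
      (c⁻¹ • (Y.mulVec l - z.2) - d.2)), ?_, ?_⟩
    · rintro (j | i | r)
      · exact mul_nonneg hcinv (hl0 j)
      · have h := hlx i
        simp only [Prod.fst_add, Prod.smul_fst, Pi.add_apply, Pi.smul_apply, smul_eq_mul] at h
        simp only [Pi.zero_apply, Sum.elim_inr, Sum.elim_inl, Pi.sub_apply, Pi.smul_apply,
          smul_eq_mul, sub_nonneg]
        rw [inv_mul_le_iff₀ hc]
        linarith
      · have h := hly r
        simp only [Prod.snd_add, Prod.smul_snd, Pi.add_apply, Pi.smul_apply, smul_eq_mul] at h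
        simp only [Pi.zero_apply, Sum.elim_inr, Pi.sub_apply, Pi.smul_apply,
          smul_eq_mul, sub_nonneg]
        rw [le_inv_mul_iff₀ hc]
        linarith
    · have hsum : ∑ j, c⁻¹ * l j = c⁻¹ := by rw [← Finset.mul_sum, hl1, mul_one]
      have hX : (X.mulVec fun j => c⁻¹ * l j) = c⁻¹ • X.mulVec l := Matrix.mulVec_smul X c⁻¹ l
      have hY : (Y.mulVec fun j => c⁻¹ * l j) = c⁻¹ • Y.mulVec l := Matrix.mulVec_smul Y c⁻¹ l
      ext k
      · simp [feasDirMap, hsum, hX]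
        ring
      · simp [feasDirMap, hsum, hY]
        ring
  · rintro ⟨w, hw, rfl⟩
    obtain ⟨k, hk0, hk1, hkx, hky⟩ := hz
    set μ : Fin n → ℝ := fun j => w (.inl j) with hμ
    set M : ℝ := ∑ j, μ j with hM
    have hM0 : 0 ≤ M := Finset.sum_nonneg fun j _ => hw _
    have hc : 0 < (M + 1)⁻¹ := by positivity
    have hcM : (M + 1)⁻¹ * M = 1 - (M + 1)⁻¹ := by field_simp; ring
    refine ⟨(M + 1)⁻¹, hc, (M + 1)⁻¹ • μ + (M + 1)⁻¹ • k, fun j => ?_, ?_, fun i => ?_,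
      fun r => ?_⟩
    · exact add_nonneg (mul_nonneg hc.le (hw _)) (mul_nonneg hc.le (hk0 j))
    · simp only [Pi.add_apply, Pi.smul_apply, smul_eq_mul, Finset.sum_add_distrib,
        ← Finset.mul_sum, hk1, ← hM, hcM]
      ring
    · have h1 := mul_le_mul_of_nonneg_left (hkx i) hc.le
      have h2 : 0 ≤ (M + 1)⁻¹ * w (.inr (.inl i)) := mul_nonneg hc.le (hw _)
      simp only [feasDirMap, LinearMap.coe_mk, AddHom.coe_mk, ← hμ, Matrix.mulVec_add,
        Matrix.mulVec_smul, Prod.fst_add, Prod.smul_fst, Pi.add_apply, Pi.sub_apply,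
        Pi.smul_apply, smul_eq_mul, mul_add, mul_sub, ← mul_assoc, ← hM, hcM]
      linarith
    · have h1 := mul_le_mul_of_nonneg_left (hky r) hc.le
      have h2 : 0 ≤ (M + 1)⁻¹ * w (.inr (.inr r)) := mul_nonneg hc.le (hw _)
      simp only [feasDirMap, LinearMap.coe_mk, AddHom.coe_mk, ← hμ, Matrix.mulVec_add,
        Matrix.mulVec_smul, Prod.snd_add, Prod.smul_snd, Pi.add_apply, Pi.sub_apply,
        Pi.smul_apply, smul_eq_mul, mul_sub, ← mul_assoc, ← hM, hcM]
      linarith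

open Filter Topology

open Classical in
/-- The direction which worsens by `t` the coordinates of `z` that are ideal and improves by
`1 - t` all the others. -/
def tiltDir (X : Matrix (Fin m) (Fin n) ℝ) (Y : Matrix (Fin s) (Fin n) ℝ)
    (z : (Fin m → ℝ) × (Fin s → ℝ)) (t : ℝ) : (Fin m → ℝ) × (Fin s → ℝ) :=
  (fun i => if z.1 i = xmin X i then t else t - 1,
   fun r => if z.2 r = ymax Y r then -t else 1 - t)

theorem continuous_tiltDir (z : (Fin m → ℝ) × (Fin s → ℝ)) : Continuous (tiltDir X Y z) := by
  refine Continuous.prodMk (continuous_pi fun i => ?_) (continuous_pi fun r => ?_)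
  · split_ifs <;> fun_prop
  · split_ifs <;> fun_prop

/-- A small step along a direction that moves ideal coordinates away from the ideal point leaves
no coordinate ideal. -/
theorem eventually_tilt_not_ideal (z : (Fin m → ℝ) × (Fin s → ℝ)) {t : ℝ} (ht : 0 < t) :
    ∀ᶠ c : ℝ in 𝓝[>] 0, (∀ i, (z + c • tiltDir X Y z t).1 i ≠ xmin X i) ∧
      ∀ r, (z + c • tiltDir X Y z t).2 r ≠ ymax Y r := by
  have hcont : Continuous fun c : ℝ => z + c • tiltDir X Y z t := by fun_prop
  refine .and (eventually_all.mpr fun i => ?_) (eventually_all.mpr fun r => ?_)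
  · by_cases h : z.1 i = xmin X i
    · filter_upwards [self_mem_nhdsWithin] with c hc
      have : 0 < c * t := mul_pos hc ht
      simp only [tiltDir, Prod.fst_add, Prod.smul_fst, Pi.add_apply, Pi.smul_apply, smul_eq_mul,
        h, if_true]
      linarith
    · have hc : Continuous fun c : ℝ => (z + c • tiltDir X Y z t).1 i :=
        (continuous_apply i).comp (continuous_fst.comp hcont)
      exact nhdsWithin_le_nhds (hc.continuousAt.eventually_ne (by simpa using h))
  · by_cases h : z.2 r = ymax Y r
    · filter_upwards [self_mem_nhdsWithin] with c hc
      have : 0 < c * t := mul_pos hc ht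
      simp only [tiltDir, Prod.snd_add, Prod.smul_snd, Pi.add_apply, Pi.smul_apply, smul_eq_mul,
        h, if_true]
      linarith
    · have hc : Continuous fun c : ℝ => (z + c • tiltDir X Y z t).2 r :=
        (continuous_apply r).comp (continuous_snd.comp hcont)
      exact nhdsWithin_le_nhds (hc.continuousAt.eventually_ne (by simpa using h))

/-- In an ideal technology, all non-ideal coordinates of a point of `T` that is not strongly
efficient can be improved simultaneously. -/
theorem IdealTech.exists_improve (hIT : IdealTech X Y) {u z : (Fin m → ℝ) × (Fin s → ℝ)}
    (hu : u ∈ Tset X Y) (hz : z ∈ Tset X Y) (huz : Dom u z) :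
    ∃ c : ℝ, 0 < c ∧ z + c • tiltDir X Y z 0 ∈ Tset X Y := by
  set K := {d : (Fin m → ℝ) × (Fin s → ℝ) | ∃ c : ℝ, 0 < c ∧ z + c • d ∈ Tset X Y} with hK
  have hKcl : IsClosed K := isClosed_feasDir hz
  have hone : tiltDir X Y z 1 ∈ K := by
    refine ⟨1, one_pos, mem_Tset_of_weakDom hz ⟨fun i => ?_, fun r => ?_⟩⟩
    · simp only [tiltDir, one_smul, Prod.fst_add, Pi.add_apply]
      split_ifs <;> linarith
    · simp only [tiltDir, one_smul, Prod.snd_add, Pi.add_apply]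
      split_ifs <;> linarith
  obtain ⟨t₀, ⟨ht₀, ht₀K⟩, hmin⟩ :=
    (isCompact_Icc.inter_right (hKcl.preimage (continuous_tiltDir z))).exists_isLeast
      ⟨(1 : ℝ), ⟨zero_le_one, le_rfl⟩, hone⟩
  rcases ht₀.1.eq_or_lt with h0 | hpos
  · subst h0
    exact ht₀K
  exfalso
  obtain ⟨c₀, hc₀, hc₀T⟩ := ht₀K
  obtain ⟨c, ⟨hcx, hcy⟩, hcpos, hcle⟩ :=
    ((eventually_tilt_not_ideal z hpos).and (Ioo_mem_nhdsGT (half_pos hc₀))).exists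
  set g := tiltDir X Y z t₀ with hg
  have hstep : ∀ b : ℝ, 0 ≤ b → b ≤ c₀ → z + b • g ∈ Tset X Y := by
    intro b hb hbc
    have h := convex_Tset hz hc₀T (sub_nonneg.mpr ((div_le_one hc₀).mpr hbc))
      (div_nonneg hb hc₀.le) (by ring)
    convert h using 1
    rw [smul_add, smul_smul, div_mul_cancel₀ _ hc₀.ne']
    module
  have hwT : z + c • g ∈ Tset X Y := hstep c hcpos.le (by linarith)
  have hw : z + c • g ∈ weakFrontier X Y := by
    refine ⟨⟨subset_closure hwT, fun hint => ?_⟩, fun hS => ?_⟩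
    · have hcont : Continuous fun t : ℝ => z + c • tiltDir X Y z t :=
        continuous_const.add ((continuous_tiltDir z).const_smul c)
      have hev : ∀ᶠ t in 𝓝[<] t₀, z + c • tiltDir X Y z t ∈ Tset X Y :=
        nhdsWithin_le_nhds (hcont.continuousAt.eventually (mem_interior_iff_mem_nhds.mp hint))
      obtain ⟨t, htT, ht0, htlt⟩ := (hev.and (Ioo_mem_nhdsLT hpos)).exists
      exact absurd (hmin ⟨⟨ht0.le, htlt.le.trans ht₀.2⟩, c, hcpos, htT⟩) (not_le.mpr htlt)
    · have hmid := convex_Tset (hstep (2 * c) (by linarith) (by linarith)) hu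
        (a := 1 / 2) (b := 1 / 2) (by norm_num) (by norm_num) (by norm_num)
      have heq : (1 / 2 : ℝ) • (z + (2 * c) • g) + (1 / 2 : ℝ) • u =
          (z + c • g) + (1 / 2 : ℝ) • (u - z) := by module
      rw [heq] at hmid
      refine hS.2 _ hmid ⟨⟨fun i => ?_, fun r => ?_⟩, fun h => huz.2 ?_⟩
      · have := huz.1.1 i
        simp only [Prod.fst_add, Prod.smul_fst, Prod.fst_sub, Pi.add_apply, Pi.smul_apply,
          Pi.sub_apply, smul_eq_mul]
        linarith
      · have := huz.1.2 r
        simp only [Prod.snd_add, Prod.smul_snd, Prod.snd_sub, Pi.add_apply, Pi.smul_apply,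
          Pi.sub_apply, smul_eq_mul]
        linarith
      · rw [add_eq_left, smul_eq_zero] at h
        exact sub_eq_zero.mp (h.resolve_left (by norm_num))
  rcases hIT _ hw with ⟨i, hi⟩ | ⟨r, hr⟩
  · exact hcx i hi
  · exact hcy r hr

end Technology

section Path

open Filter Topology

variable (P : GSPsi)

theorem GSPsi.isOpen_D : IsOpen P.D := by
  have hx : IsOpen P.Dx := by rcases P.hDx with h | h <;> simp [h, isOpen_Ioi]
  have hy : IsOpen P.Dy := by rcases P.hDy with h | h <;> simp [h, isOpen_Ioi]
  exact hx.inter hy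

/-- The fraction of the distance to `xmin` that remains at the parameter `θ`. -/
def GSPsi.remX (θmin θ : ℝ) : ℝ := (1 - P.ψx θmin)⁻¹ * (P.ψx θ - P.ψx θmin)

/-- The fraction of the distance to `ymax` that remains at the parameter `θ`. -/
def GSPsi.remY (θmin θ : ℝ) : ℝ := (P.ψy θmin - 1)⁻¹ * (P.ψy θmin - P.ψy θ)

variable {P} {θmin θ : ℝ}

theorem GSPsi.ψx_lt_one (hD : θmin ∈ P.D) (h1 : θmin < 1) : P.ψx θmin < 1 := by
  simpa [P.hψx_one] using P.hψx_mono hD.1 P.hone_x h1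

theorem GSPsi.one_lt_ψy (hD : θmin ∈ P.D) (h1 : θmin < 1) : 1 < P.ψy θmin := by
  simpa [P.hψy_one] using P.hψy_anti hD.2 P.hone_y h1

theorem GSPsi.remX_pos (hD : θmin ∈ P.D) (h1 : θmin < 1) (hθD : θ ∈ P.D) (h : θmin < θ) :
    0 < P.remX θmin θ :=
  mul_pos (inv_pos.mpr (sub_pos.mpr (ψx_lt_one hD h1)))
    (sub_pos.mpr (P.hψx_mono hD.1 hθD.1 h))

theorem GSPsi.remX_nonpos (hD : θmin ∈ P.D) (h1 : θmin < 1) (hθD : θ ∈ P.D) (h : θ ≤ θmin) :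
    P.remX θmin θ ≤ 0 :=
  mul_nonpos_of_nonneg_of_nonpos (inv_pos.mpr (sub_pos.mpr (ψx_lt_one hD h1))).le
    (sub_nonpos.mpr (P.hψx_mono.monotoneOn hθD.1 hD.1 h))

theorem GSPsi.remY_pos (hD : θmin ∈ P.D) (h1 : θmin < 1) (hθD : θ ∈ P.D) (h : θmin < θ) :
    0 < P.remY θmin θ :=
  mul_pos (inv_pos.mpr (sub_pos.mpr (one_lt_ψy hD h1)))
    (sub_pos.mpr (P.hψy_anti hD.2 hθD.2 h))

theorem GSPsi.remY_nonpos (hD : θmin ∈ P.D) (h1 : θmin < 1) (hθD : θ ∈ P.D) (h : θ ≤ θmin) :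
    P.remY θmin θ ≤ 0 :=
  mul_nonpos_of_nonneg_of_nonpos (inv_pos.mpr (sub_pos.mpr (one_lt_ψy hD h1))).le
    (sub_nonpos.mpr (P.hψy_anti.antitoneOn hθD.2 hD.2 h))

theorem GSPsi.continuousAt_remX (hθD : θ ∈ P.D) : ContinuousAt (P.remX θmin) θ := by
  have h : ContinuousAt P.ψx θ := (P.hψx_diff.continuousOn.mono Set.inter_subset_left).continuousAt
    (P.isOpen_D.mem_nhds hθD)
  exact continuousAt_const.mul (h.sub continuousAt_const)

theorem GSPsi.continuousAt_remY (hθD : θ ∈ P.D) : ContinuousAt (P.remY θmin) θ := by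
  have h : ContinuousAt P.ψy θ := (P.hψy_diff.continuousOn.mono Set.inter_subset_right).continuousAt
    (P.isOpen_D.mem_nhds hθD)
  exact continuousAt_const.mul (continuousAt_const.sub h)

variable {X : Matrix (Fin m) (Fin n) ℝ} {Y : Matrix (Fin s) (Fin n) ℝ}

theorem pathR_fst_apply (hD : θmin ∈ P.D) (h1 : θmin < 1) (p : (Fin m → ℝ) × (Fin s → ℝ))
    (θ : ℝ) (i : Fin m) :
    (pathR P X Y θmin p θ).1 i = xmin X i + P.remX θmin θ * (p.1 i - xmin X i) := by
  have h : 1 - P.ψx θmin ≠ 0 := (sub_pos.mpr (GSPsi.ψx_lt_one hD h1)).ne'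
  simp only [pathR, pathRx, rangeDir, GSPsi.remX, Pi.add_apply, Pi.smul_apply, Pi.sub_apply,
    smul_eq_mul]
  field_simp
  ring

theorem pathR_snd_apply (hD : θmin ∈ P.D) (h1 : θmin < 1) (p : (Fin m → ℝ) × (Fin s → ℝ))
    (θ : ℝ) (r : Fin s) :
    (pathR P X Y θmin p θ).2 r = ymax Y r - P.remY θmin θ * (ymax Y r - p.2 r) := by
  have h : P.ψy θmin - 1 ≠ 0 := (sub_pos.mpr (GSPsi.one_lt_ψy hD h1)).ne'
  simp only [pathR, pathRy, rangeDir, GSPsi.remY, Pi.add_apply, Pi.smul_apply, Pi.sub_apply,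
    smul_eq_mul]
  field_simp
  ring

theorem feasibleR_iff {p : (Fin m → ℝ) × (Fin s → ℝ)} :
    feasibleR P X Y θmin p θ ↔ θ ∈ P.D ∧ pathR P X Y θmin p θ ∈ Tset X Y := Iff.rfl

/-- Paths starting in `T` reach the ideal point at `θmin`, so smaller parameters are infeasible
when the ideal point is not in `T`. -/
theorem lt_of_feasibleR (hideal : idealPoint X Y ∉ Tset X Y) (hD : θmin ∈ P.D) (h1 : θmin < 1)
    {p : (Fin m → ℝ) × (Fin s → ℝ)} (hp : p ∈ Tset X Y) (hf : feasibleR P X Y θmin p θ) :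
    θmin < θ := by
  rw [feasibleR_iff] at hf
  by_contra! hle
  refine hideal (mem_Tset_of_weakDom hf.2 ⟨fun i => ?_, fun r => ?_⟩)
  · rw [pathR_fst_apply hD h1]
    have := mul_nonpos_of_nonpos_of_nonneg (GSPsi.remX_nonpos hD h1 hf.1 hle)
      (sub_nonneg.mpr (xmin_le_of_mem_Tset hp i))
    simp only [idealPoint]
    linarith
  · rw [pathR_snd_apply hD h1]
    have := mul_nonpos_of_nonpos_of_nonneg (GSPsi.remY_nonpos hD h1 hf.1 hle)
      (sub_nonneg.mpr (le_ymax_of_mem_Tset hp r))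
    simp only [idealPoint]
    linarith

/-- Before the ideal point is reached, paths preserve dominance. -/
theorem Dom.pathR (hD : θmin ∈ P.D) (h1 : θmin < 1) (hθD : θ ∈ P.D) (h : θmin < θ)
    {p q : (Fin m → ℝ) × (Fin s → ℝ)} (hpq : Dom p q) :
    Dom (pathR P X Y θmin p θ) (pathR P X Y θmin q θ) := by
  have hα := GSPsi.remX_pos hD h1 hθD h
  have hβ := GSPsi.remY_pos hD h1 hθD h
  refine ⟨⟨fun i => ?_, fun r => ?_⟩, fun heq => hpq.2 (Prod.ext (funext fun i => ?_)
    (funext fun r => ?_))⟩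
  · rw [pathR_fst_apply hD h1, pathR_fst_apply hD h1]
    have := mul_le_mul_of_nonneg_left (hpq.1.1 i) hα.le
    linarith
  · rw [pathR_snd_apply hD h1, pathR_snd_apply hD h1]
    have := mul_le_mul_of_nonneg_left (hpq.1.2 r) hβ.le
    linarith
  · have := congrFun (congrArg Prod.fst heq) i
    rw [pathR_fst_apply hD h1, pathR_fst_apply hD h1] at this
    exact mul_left_cancel₀ hα.ne' (by linarith)
  · have := congrFun (congrArg Prod.snd heq) r
    rw [pathR_snd_apply hD h1, pathR_snd_apply hD h1] at this
    exact mul_left_cancel₀ hβ.ne' (by linarith)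

/-- A path moved slightly below a parameter `θ` stays weakly dominated by the point obtained from
its value at `θ` by improving all non-ideal coordinates. -/
theorem eventually_weakDom_pathR (hD : θmin ∈ P.D) (h1 : θmin < 1) (hθD : θ ∈ P.D)
    (h : θmin < θ) (q : (Fin m → ℝ) × (Fin s → ℝ)) {c : ℝ} (hc : 0 < c) :
    ∀ᶠ θ' in 𝓝 θ, WeakDom
      (pathR P X Y θmin q θ + c • tiltDir X Y (pathR P X Y θmin q θ) 0)
      (pathR P X Y θmin q θ') := by
  refine .and (eventually_all.mpr fun i => ?_) (eventually_all.mpr fun r => ?_)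
  · by_cases hi : (pathR P X Y θmin q θ).1 i = xmin X i
    · refine .of_forall fun θ' => le_of_eq ?_
      have hq : q.1 i - xmin X i = 0 := by
        have hi' := hi
        rw [pathR_fst_apply hD h1, add_eq_left] at hi'
        exact (mul_eq_zero.mp hi').resolve_left (GSPsi.remX_pos hD h1 hθD h).ne'
      rw [pathR_fst_apply hD h1 q θ', hq]
      simp [tiltDir, hi]
    · have hcont : ContinuousAt (fun θ' => (pathR P X Y θmin q θ').1 i) θ := by
        simp only [pathR_fst_apply hD h1]
        exact continuousAt_const.add ((GSPsi.continuousAt_remX hθD).mul continuousAt_const)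
      filter_upwards [hcont.eventually (lt_mem_nhds (sub_lt_self _ hc))] with θ' hθ'
      simp only [tiltDir, Prod.fst_add, Prod.smul_fst, Pi.add_apply, Pi.smul_apply, smul_eq_mul,
        if_neg hi]
      linarith
  · by_cases hr : (pathR P X Y θmin q θ).2 r = ymax Y r
    · refine .of_forall fun θ' => le_of_eq ?_
      have hq : ymax Y r - q.2 r = 0 := by
        have hr' := hr
        rw [pathR_snd_apply hD h1, sub_eq_self] at hr'
        exact (mul_eq_zero.mp hr').resolve_left (GSPsi.remY_pos hD h1 hθD h).ne'
      rw [pathR_snd_apply hD h1 q θ', hq]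
      simp [tiltDir, hr]
    · have hcont : ContinuousAt (fun θ' => (pathR P X Y θmin q θ').2 r) θ := by
        simp only [pathR_snd_apply hD h1]
        exact continuousAt_const.sub ((GSPsi.continuousAt_remY hθD).mul continuousAt_const)
      filter_upwards [hcont.eventually (gt_mem_nhds (lt_add_of_pos_right _ hc))] with θ' hθ'
      simp only [tiltDir, Prod.snd_add, Prod.smul_snd, Pi.add_apply, Pi.smul_apply, smul_eq_mul,
        if_neg hr]
      linarith

end Path

/-- over an ideal technology not containing the ideal point, the GS model
with GS range directions is strictly monotone. -/
theorem stmt9 (hn : 0 < n) (X : Matrix (Fin m) (Fin n) ℝ) (Y : Matrix (Fin s) (Fin n) ℝ)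
    (hIT : IdealTech X Y) (hideal : idealPoint X Y ∉ Tset X Y)
    (P : GSPsi) (θmin : ℝ) (hθ : θmin ∈ Set.Ico (0 : ℝ) 1 ∩ P.D)
    (score : ((Fin m → ℝ) × (Fin s → ℝ)) → ℝ)
    (hscore : ∀ p ∈ Tset X Y, IsLeast {θ | feasibleR P X Y θmin p θ} (score p)) :
    ∀ p ∈ Tset X Y, ∀ q ∈ Tset X Y, Dom p q → score q < score p := by
  intro p hp q hq hpq
  obtain ⟨⟨hθ0, hθ1⟩, hD⟩ := hθ
  have hf := (hscore p hp).1
  have hlt : θmin < score p := lt_of_feasibleR hideal hD hθ1 hp hf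
  obtain ⟨hpD, hpT⟩ := feasibleR_iff.mp hf
  have hdom := hpq.pathR (X := X) (Y := Y) hD hθ1 hpD hlt
  obtain ⟨c, hc, hcT⟩ := hIT.exists_improve hpT (mem_Tset_of_weakDom hpT hdom.1) hdom
  have hev := (eventually_weakDom_pathR (X := X) (Y := Y) hD hθ1 hpD hlt q hc).and
    (P.isOpen_D.mem_nhds hpD)
  obtain ⟨θ, ⟨hθdom, hθD⟩, hθlt⟩ :=
    ((hev.filter_mono nhdsWithin_le_nhds).and (self_mem_nhdsWithin (s := Set.Iio (score p)))).exists
  exact ((hscore q hq).2 (feasibleR_iff.mpr ⟨hθD, mem_Tset_of_weakDom hcT hθdom⟩)).trans_lt hθlt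

end
end

section
/- The VRS technology set T is an ideal technology if and only if the following holds for the generating data: for each input index i' ∈ {1,…,m} there exists j ∈ {1,…,n} such that X_{ij} = x^min_i for all i ≠ i' and Y_{rj} = y^max_r for all r ∈ {1,…,s}; and for each output index r' ∈ {1,…,s} there exists j ∈ {1,…,n} such that X_{ij} = x^min_i for all i ∈ {1,…,m} and Y_{rj} = y^max_r for all r ≠ r'. -/
open Finset

noncomputable section

variable {m s n : ℕ}

section MinOriented

variable {ι κ : Type*} [Fintype κ]

/-- The set of points lying above some convex combination of the columns of `G`. -/
def upperHull (G : Matrix ι κ ℝ) : Set (ι → ℝ) :=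
  {z | ∃ lam ∈ stdSimplex ℝ κ, G.mulVec lam ≤ z}

open scoped Pointwise in
theorem isClosed_upperHull (G : Matrix ι κ ℝ) : IsClosed (upperHull G) := by
  have hK : IsCompact ((fun lam => G.mulVec lam) '' stdSimplex ℝ κ) :=
    (isCompact_stdSimplex ℝ κ).image (by fun_prop)
  have h : upperHull G = (Set.Ici 0 : Set (ι → ℝ)) + (fun lam => G.mulVec lam) '' stdSimplex ℝ κ := by
    ext z
    constructor
    · rintro ⟨lam, hlam, hz⟩
      exact ⟨z - G.mulVec lam, sub_nonneg.2 hz, _, ⟨lam, hlam, rfl⟩, sub_add_cancel _ _⟩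
    · rintro ⟨c, hc, _, ⟨lam, hlam, rfl⟩, rfl⟩
      exact ⟨lam, hlam, le_add_of_nonneg_left hc⟩
  rw [h]
  exact isClosed_Ici.add_right_of_isCompact hK

theorem column_mem_upperHull [DecidableEq κ] (G : Matrix ι κ ℝ) (j : κ) {z : ι → ℝ}
    (hz : ∀ l, G l j ≤ z l) : z ∈ upperHull G :=
  ⟨Pi.single j 1, single_mem_stdSimplex ℝ j, fun l => by simpa using hz l⟩

theorem convex_upperHull (G : Matrix ι κ ℝ) : Convex ℝ (upperHull G) := by
  rintro x ⟨u, hu, hx⟩ y ⟨v, hv, hy⟩ α β hα hβ hαβ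
  refine ⟨α • u + β • v, convex_stdSimplex ℝ κ hu hv hα hβ hαβ, ?_⟩
  rw [Matrix.mulVec_add, Matrix.mulVec_smul, Matrix.mulVec_smul]
  gcongr

theorem mem_interior_upperHull [Finite ι] {G : Matrix ι κ ℝ} {q z : ι → ℝ}
    (hq : q ∈ upperHull G) (h : ∀ l, q l < z l) : z ∈ interior (upperHull G) := by
  refine mem_interior.2 ⟨Set.univ.pi fun l => Set.Ioi (q l), ?_,
    isOpen_set_pi Set.finite_univ fun l _ => isOpen_Ioi, fun l _ => h l⟩
  intro w hw
  obtain ⟨lam, hlam, hle⟩ := hq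
  exact ⟨lam, hlam, hle.trans fun l => (hw l trivial).le⟩

theorem iInf_le_row (G : Matrix ι κ ℝ) (l : ι) (j : κ) : ⨅ j, G l j ≤ G l j :=
  ciInf_le (Set.finite_range _).bddBelow j

theorem iInf_le_of_mem_upperHull {G : Matrix ι κ ℝ} {z : ι → ℝ} (hz : z ∈ upperHull G)
    (l : ι) : ⨅ j, G l j ≤ z l := by
  obtain ⟨lam, ⟨h0, h1⟩, hle⟩ := hz
  calc ⨅ j, G l j = ∑ j, (⨅ j, G l j) * lam j := by rw [← Finset.mul_sum, h1, mul_one]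
    _ ≤ ∑ j, G l j * lam j :=
      Finset.sum_le_sum fun j _ => mul_le_mul_of_nonneg_right (iInf_le_row G l j) (h0 j)
    _ ≤ z l := hle l

theorem exists_eq_iInf_of_frontier [Finite ι] {G : Matrix ι κ ℝ}
    (h : ∀ k, ∃ j, ∀ l, l ≠ k → G l j = ⨅ j, G l j) {z : ι → ℝ}
    (hz : z ∈ frontier (upperHull G)) (hmin : ¬ Minimal (· ∈ upperHull G) z) :
    ∃ k, z k = ⨅ j, G k j := by
  classical
  rw [(isClosed_upperHull G).frontier_eq] at hz
  obtain ⟨hzU, hzI⟩ := hz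
  by_contra! hne
  have hlt : ∀ l, ⨅ j, G l j < z l := fun l =>
    lt_of_le_of_ne (iInf_le_of_mem_upperHull hzU l) (hne l).symm
  simp only [Minimal, not_and, not_forall] at hmin
  obtain ⟨q, hqU, hqz, hnle⟩ := hmin hzU
  simp only [Pi.le_def, not_forall, not_le] at hnle
  obtain ⟨k, hk⟩ := hnle
  obtain ⟨j, hj⟩ := h k
  obtain ⟨δ, ⟨hδ0, hδ1⟩, hδ⟩ :
      ∃ δ ∈ Set.Ioo (0 : ℝ) 1, (1 - δ) * q k + δ * G k j < z k := by
    have hc : Filter.Tendsto (fun δ : ℝ => (1 - δ) * q k + δ * G k j)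
        (nhdsWithin 0 (Set.Ioi 0)) (nhds (q k)) := by
      have : Continuous fun δ : ℝ => (1 - δ) * q k + δ * G k j := by fun_prop
      simpa using (this.tendsto 0).mono_left nhdsWithin_le_nhds
    obtain ⟨δ, hδ⟩ := ((hc.eventually (gt_mem_nhds hk)).and
      (Ioo_mem_nhdsGT (zero_lt_one' ℝ))).exists
    exact ⟨δ, hδ.2, hδ.1⟩
  refine hzI (mem_interior_upperHull (convex_upperHull G hqU
    (column_mem_upperHull G j fun _ => le_rfl) (sub_nonneg.2 hδ1.le) hδ0.le
    (sub_add_cancel 1 δ)) fun l => ?_)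
  simp only [Pi.add_apply, Pi.smul_apply, smul_eq_mul]
  rcases eq_or_ne l k with rfl | hl
  · exact hδ
  · rw [hj l hl]
    nlinarith [mul_le_mul_of_nonneg_left (hqz l) (sub_nonneg.2 hδ1.le),
      mul_lt_mul_of_pos_left (hlt l) hδ0]

theorem exists_column_eq_iInf_of_ne [Fintype ι] [Nonempty κ] {G : Matrix ι κ ℝ}
    (h : ∀ z ∈ frontier (upperHull G), ¬ Minimal (· ∈ upperHull G) z →
      ∃ k, z k = ⨅ j, G k j) (k : ι) :
    ∃ j, ∀ l, l ≠ k → G l j = ⨅ j, G l j := by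
  classical
  by_contra! hno
  obtain ⟨j₀⟩ := ‹Nonempty κ›
  set M : ℝ := ∑ j, |G k j| + 1
  have hGM : ∀ j, G k j < M := fun j => by
    have := Finset.single_le_sum (f := fun j => |G k j|) (fun j _ => abs_nonneg _)
      (Finset.mem_univ j)
    linarith [le_abs_self (G k j)]
  set z : ℝ → ι → ℝ := fun t => Function.update (fun l => (⨅ j, G l j) + t) k M
  have hzc : Continuous z :=
    Continuous.update (by fun_prop) k continuous_const
  have hzk : ∀ t, z t k = M := fun t => Function.update_self _ _ _
  have hzl : ∀ t l, l ≠ k → z t l = (⨅ j, G l j) + t := fun t l hl =>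
    Function.update_of_ne hl _ _
  have hpos : ∀ t ∈ z ⁻¹' upperHull G, 0 < t := by
    rintro t ⟨lam, ⟨h0, h1⟩, hle⟩
    obtain ⟨j, -, hj⟩ := Finset.exists_lt_of_sum_lt (s := Finset.univ)
      (f := fun _ : κ => (0 : ℝ)) (g := lam) (by simp [h1])
    obtain ⟨l, hl, hne⟩ := hno j
    have hlt : ∑ j, (⨅ j, G l j) * lam j < ∑ j, G l j * lam j :=
      Finset.sum_lt_sum
        (fun j _ => mul_le_mul_of_nonneg_right (iInf_le_row G l j) (h0 j))
        ⟨j, Finset.mem_univ j,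
          mul_lt_mul_of_pos_right (lt_of_le_of_ne (iInf_le_row G l j) hne.symm) hj⟩
    rw [← Finset.mul_sum, h1, mul_one] at hlt
    have := hlt.trans_le (hle l)
    rw [hzl t l hl] at this
    linarith
  have hne : (z ⁻¹' upperHull G).Nonempty := by
    refine ⟨∑ l, (G l j₀ - ⨅ j, G l j), column_mem_upperHull G j₀ fun l => ?_⟩
    rcases eq_or_ne l k with rfl | hl
    · rw [hzk]
      exact (hGM j₀).le
    · rw [hzl _ l hl]
      have := Finset.single_le_sum (f := fun l => G l j₀ - ⨅ j, G l j)
        (fun l _ => sub_nonneg.2 (iInf_le_row G l j₀)) (Finset.mem_univ l)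
      linarith
  have hbdd : BddBelow (z ⁻¹' upperHull G) := ⟨0, fun t ht => (hpos t ht).le⟩
  have hmem := ((isClosed_upperHull G).preimage hzc).csInf_mem hne hbdd
  set t := sInf (z ⁻¹' upperHull G)
  have htpos := hpos t hmem
  have hfr : z t ∈ frontier (upperHull G) := by
    rw [(isClosed_upperHull G).frontier_eq]
    refine ⟨hmem, fun hI => ?_⟩
    have hnhds : z ⁻¹' interior (upperHull G) ∈ nhds t :=
      (isOpen_interior.preimage hzc).mem_nhds hI
    obtain ⟨u, hut, hu⟩ := (mem_nhds_iff_exists_Ioo_subset.1 hnhds)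
    obtain ⟨v, hv1, hv2⟩ := exists_between hu.1.1
    have hv := interior_subset (hu.2 ⟨hv1, hv2.trans hu.1.2⟩)
    exact (csInf_le hbdd hv).not_gt hv2
  have hnmin : ¬ Minimal (· ∈ upperHull G) (z t) := by
    intro hmin
    obtain ⟨lam, ⟨h0, h1⟩, hle⟩ := hmem
    have hk := hmin.2 ⟨lam, ⟨h0, h1⟩, le_rfl⟩ hle k
    rw [hzk] at hk
    have hsum : ∑ j, G k j * lam j < ∑ j, M * lam j := by
      obtain ⟨j, -, hj⟩ := Finset.exists_lt_of_sum_lt (s := Finset.univ)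
        (f := fun _ : κ => (0 : ℝ)) (g := lam) (by simp [h1])
      exact Finset.sum_lt_sum
        (fun j _ => mul_le_mul_of_nonneg_right (hGM j).le (h0 j))
        ⟨j, Finset.mem_univ j, mul_lt_mul_of_pos_right (hGM j) hj⟩
    rw [← Finset.mul_sum, h1, mul_one] at hsum
    exact hk.not_gt hsum
  obtain ⟨l, hl⟩ := h _ hfr hnmin
  rcases eq_or_ne l k with rfl | hlk
  · rw [hzk] at hl
    exact (hl ▸ iInf_le_row G l j₀).not_gt (hGM j₀)
  · rw [hzl t l hlk] at hl
    linarith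

end MinOriented

/-- Outputs with their sign changed become further coordinates to be minimised. -/
def minOriented (m s : ℕ) : ((Fin m → ℝ) × (Fin s → ℝ)) ≃ₜ (Fin m ⊕ Fin s → ℝ) where
  toFun p := Sum.elim p.1 (-p.2)
  invFun z := (fun i => z (Sum.inl i), fun r => -z (Sum.inr r))
  left_inv p := by ext <;> simp
  right_inv z := by ext (i | r) <;> simp
  continuous_toFun := continuous_pi (by rintro (i | r) <;> simp <;> fun_prop)
  continuous_invFun := by fun_prop

theorem minOriented_le_iff {p q : (Fin m → ℝ) × (Fin s → ℝ)} :
    minOriented m s p ≤ minOriented m s q ↔ WeakDom p q := by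
  simp [minOriented, WeakDom, Pi.le_def]

/-- The data matrix with sign-changed outputs. -/
def minData (X : Matrix (Fin m) (Fin n) ℝ) (Y : Matrix (Fin s) (Fin n) ℝ) :
    Matrix (Fin m ⊕ Fin s) (Fin n) ℝ :=
  Matrix.fromRows X (-Y)

theorem Tset_eq_preimage (X : Matrix (Fin m) (Fin n) ℝ) (Y : Matrix (Fin s) (Fin n) ℝ) :
    Tset X Y = minOriented m s ⁻¹' upperHull (minData X Y) := by
  ext p
  have key : ∀ lam : Fin n → ℝ, (minData X Y).mulVec lam =
      minOriented m s (X.mulVec lam, Y.mulVec lam) := fun lam => by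
    simp [minData, minOriented, Matrix.fromRows_mulVec, Matrix.neg_mulVec]
  simp only [Tset, upperHull, stdSimplex, Set.mem_ofPred_eq, Set.mem_preimage, key,
    minOriented_le_iff, WeakDom, and_assoc]

theorem mem_strongFrontier_iff (X : Matrix (Fin m) (Fin n) ℝ)
    (Y : Matrix (Fin s) (Fin n) ℝ) (p : (Fin m → ℝ) × (Fin s → ℝ)) :
    p ∈ strongFrontier X Y ↔
      Minimal (· ∈ upperHull (minData X Y)) (minOriented m s p) := by
  simp only [strongFrontier, StrongEff, Dom, Set.mem_ofPred_eq, Tset_eq_preimage,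
    Set.mem_preimage, Minimal, not_and, not_not]
  refine and_congr_right fun _ => ⟨fun h z hz hle => ?_, fun h q hq hd => ?_⟩
  · obtain ⟨q, rfl⟩ := (minOriented m s).surjective z
    exact (h q hz (minOriented_le_iff.1 hle) ▸ le_rfl)
  · have hle := minOriented_le_iff.2 hd
    exact (minOriented m s).injective (le_antisymm hle (h hq hle))

theorem mem_weakFrontier_iff (X : Matrix (Fin m) (Fin n) ℝ)
    (Y : Matrix (Fin s) (Fin n) ℝ) (p : (Fin m → ℝ) × (Fin s → ℝ)) :
    p ∈ weakFrontier X Y ↔ minOriented m s p ∈ frontier (upperHull (minData X Y)) ∧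
      ¬ Minimal (· ∈ upperHull (minData X Y)) (minOriented m s p) := by
  rw [weakFrontier, Set.mem_sdiff, mem_strongFrontier_iff, Tset_eq_preimage,
    ← Homeomorph.preimage_frontier, Set.mem_preimage]

theorem iInf_minData_inr (X : Matrix (Fin m) (Fin n) ℝ) (Y : Matrix (Fin s) (Fin n) ℝ)
    (r : Fin s) : ⨅ j, minData X Y (Sum.inr r) j = -ymax Y r := by
  have h : (fun j => minData X Y (Sum.inr r) j) = fun j => -Y r j := by
    ext j
    simp [minData]
  rw [h, ymax, iInf, Real.sInf_def, iSup]
  congr 2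
  ext x
  simp [neg_eq_iff_eq_neg]

theorem idealTech_iff (X : Matrix (Fin m) (Fin n) ℝ) (Y : Matrix (Fin s) (Fin n) ℝ) :
    IdealTech X Y ↔ ∀ z ∈ frontier (upperHull (minData X Y)),
      ¬ Minimal (· ∈ upperHull (minData X Y)) z → ∃ k, z k = ⨅ j, minData X Y k j := by
  rw [IdealTech, (minOriented m s).surjective.forall]
  refine forall_congr' fun p => ?_
  rw [mem_weakFrontier_iff, and_imp, Sum.exists]
  simp only [iInf_minData_inr]
  simp [minOriented, minData, xmin]

/-- `T` is an ideal technology iff for each input-output coordinate there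
is a generating DMU coinciding with the ideal point except perhaps in that
coordinate. -/
theorem stmt14 (hn : 0 < n) (X : Matrix (Fin m) (Fin n) ℝ)
    (Y : Matrix (Fin s) (Fin n) ℝ) :
    IdealTech X Y ↔
      (∀ i' : Fin m, ∃ j : Fin n,
        (∀ i, i ≠ i' → X i j = xmin X i) ∧ (∀ r, Y r j = ymax Y r)) ∧
      (∀ r' : Fin s, ∃ j : Fin n,
        (∀ i, X i j = xmin X i) ∧ (∀ r, r ≠ r' → Y r j = ymax Y r)) := by
  have : Nonempty (Fin n) := ⟨⟨0, hn⟩⟩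
  have hcol : IdealTech X Y ↔
      ∀ k, ∃ j, ∀ l, l ≠ k → minData X Y l j = ⨅ j, minData X Y l j := by
    rw [idealTech_iff]
    exact ⟨exists_column_eq_iInf_of_ne, fun h _ => exists_eq_iInf_of_frontier h⟩
  rw [hcol, Sum.forall]
  simp only [Sum.forall, iInf_minData_inr]
  simp [minData, xmin]

end
end
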